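/- Let S be a densely defined, closed, symmetric operator in H with S ≥ ε I (ε > 0), Q = I - P_{ker(S*)} the orthogonal projection onto (ker S*)^⊥, and Ŝ_K the reduced Krein–von Neumann operator. Then the map u ↦ Q u is a bijection from dom(S) onto dom(Ŝ_K). -/

import Mathlib

open Filter Topology

noncomputable section

variable {H : Type*} [NormedAddCommGroup H] [InnerProductSpace ℂ H] [CompleteSpace H]

local notation "⟪" x ", " y "⟫" => @inner ℂ _ _ x y

/-- Standing hypothesis: `S` is densely defined, closed, symmetric, and `S ≥ ε`. -/
structure StandingHyp (S : H →ₗ.[ℂ] H) (ε : ℝ) : Prop where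
  dense : Dense (S.domain : Set H)
  closed : S.IsClosed
  symmetric : ∀ u v : S.domain, ⟪(S u : H), (v : H)⟫ = ⟪(u : H), (S v : H)⟫
  pos : 0 < ε
  lower : ∀ u : S.domain, ε * ‖(u : H)‖ ^ 2 ≤ (⟪(u : H), (S u : H)⟫).re

/-- Krein–von Neumann extension, via the Ando–Nishio intrinsic description. -/
def IsKreinVonNeumannExtension (S Sk : H →ₗ.[ℂ] H) : Prop :=
  Sk ≤ S.adjoint ∧
  ∀ v : H, v ∈ Sk.domain ↔ ∃ hv : v ∈ S.adjoint.domain, ∃ f : ℕ → S.domain,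
    Tendsto (fun j => (S (f j) : H)) atTop (nhds (S.adjoint ⟨v, hv⟩)) ∧
    ∀ δ : ℝ, 0 < δ → ∃ N : ℕ, ∀ j ≥ N, ∀ k ≥ N,
      ‖⟪((f j - f k : S.domain) : H), (S (f j - f k) : H)⟫‖ < δ

/-- Friedrichs extension, via Freudenthal's intrinsic description. -/
def IsFriedrichsExtension (S Sf : H →ₗ.[ℂ] H) : Prop :=
  Sf ≤ S.adjoint ∧
  ∀ v : H, v ∈ Sf.domain ↔ v ∈ S.adjoint.domain ∧ ∃ f : ℕ → S.domain,
    Tendsto (fun j => ((f j : H))) atTop (nhds v) ∧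
    ∀ δ : ℝ, 0 < δ → ∃ N : ℕ, ∀ j ≥ N, ∀ k ≥ N,
      ‖⟪((f j - f k : S.domain) : H), (S (f j - f k) : H)⟫‖ < δ

/-- The kernel of a partially defined operator, as a submodule of `H`. -/
def pKer (A : H →ₗ.[ℂ] H) : Submodule ℂ H :=
  (LinearMap.ker A.toFun).map A.domain.subtype

/-- `q` is the orthogonal projection of `u` onto `Kᗮ`. -/
def IsOrthProjOn (K : Submodule ℂ H) (u q : H) : Prop :=
  q ∈ Kᗮ ∧ u - q ∈ Kᗮᗮ
theorem aux_mem_pKer_iff (S : H →ₗ.[ℂ] H) (hd : Dense (S.domain : Set H)) (x : H) :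
    x ∈ pKer S.adjoint ↔ ∀ u : S.domain, ⟪x, (S u : H)⟫ = 0 := by
  constructor
  · rintro ⟨y, hy, rfl⟩ u
    have h := LinearPMap.adjoint_isFormalAdjoint hd y u
    have hy0 : S.adjoint y = 0 := hy
    rw [hy0, inner_zero_left] at h
    exact h.symm
  · intro h
    have hx : x ∈ S.adjoint.domain :=
      LinearPMap.mem_adjoint_domain_of_exists x ⟨0, fun u => by rw [h u, inner_zero_left]⟩
    refine ⟨⟨x, hx⟩, ?_, rfl⟩
    exact LinearPMap.adjoint_apply_eq hd ⟨x, hx⟩ (fun u => by rw [h u, inner_zero_left])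

theorem aux_mem_pKer_of_oo (S : H →ₗ.[ℂ] H) (hd : Dense (S.domain : Set H)) (x : H)
    (hx : x ∈ (pKer S.adjoint)ᗮᗮ) : x ∈ pKer S.adjoint := by
  rw [aux_mem_pKer_iff S hd]
  intro u
  have hu : (S u : H) ∈ (pKer S.adjoint)ᗮ := by
    rw [Submodule.mem_orthogonal]
    intro y hy
    exact (aux_mem_pKer_iff S hd y).1 hy u
  exact (Submodule.mem_orthogonal' _ _).1 hx _ hu

theorem aux_bound (S : H →ₗ.[ℂ] H) (ε : ℝ) (hS : StandingHyp S ε) (u : S.domain) :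
    ε * ‖(u : H)‖ ≤ ‖(S u : H)‖ := by
  have h1 := hS.lower u
  have h2 : (⟪(u : H), (S u : H)⟫).re ≤ ‖(u : H)‖ * ‖(S u : H)‖ :=
    (Complex.re_le_norm _).trans (norm_inner_le_norm _ _)
  rcases (norm_nonneg (u : H)).eq_or_lt with h0 | h0
  · rw [← h0, mul_zero]; exact norm_nonneg _
  · refine le_of_mul_le_mul_left ?_ h0
    nlinarith

/-- The map `u ↦ (I - P_{ker S*}) u` is a bijection from `dom S` onto
`dom Ŝ_K = dom S_K ∩ (ker S*)ᗮ`. -/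
theorem projection_bijection_dom
    (S Sk : H →ₗ.[ℂ] H) (ε : ℝ) (hS : StandingHyp S ε)
    (hK : IsKreinVonNeumannExtension S Sk) :
    (∀ u : H, u ∈ S.domain → ∀ q : H, IsOrthProjOn (pKer S.adjoint) u q →
      q ∈ Sk.domain ∧ q ∈ (pKer S.adjoint)ᗮ) ∧
    (∀ u u' : H, u ∈ S.domain → u' ∈ S.domain → ∀ q : H,
      IsOrthProjOn (pKer S.adjoint) u q → IsOrthProjOn (pKer S.adjoint) u' q → u = u') ∧
    (∀ v : H, v ∈ Sk.domain → v ∈ (pKer S.adjoint)ᗮ →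
      ∃ u : H, u ∈ S.domain ∧ IsOrthProjOn (pKer S.adjoint) u v) := by
  have hd := hS.dense
  refine ⟨?_, ?_, ?_⟩
  · rintro u hu q ⟨hq, huq⟩
    refine ⟨?_, hq⟩
    have hw := (aux_mem_pKer_iff S hd _).1 (aux_mem_pKer_of_oo S hd _ huq)
    have key : ∀ x : S.domain, ⟪(S ⟨u, hu⟩ : H), (x : H)⟫ = ⟪q, (S x : H)⟫ := by
      intro x
      rw [hS.symmetric]
      have := hw x
      rw [inner_sub_left, sub_eq_zero] at this
      exact this
    have hqd : q ∈ S.adjoint.domain := LinearPMap.mem_adjoint_domain_of_exists q ⟨_, key⟩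
    refine (hK.2 q).2 ⟨hqd, fun _ => ⟨u, hu⟩, ?_, ?_⟩
    · rw [LinearPMap.adjoint_apply_eq hd ⟨q, hqd⟩ key]
      exact tendsto_const_nhds
    · intro δ hδ
      refine ⟨0, fun j _ k _ => ?_⟩
      simpa using hδ
  · rintro u u' hu hu' q ⟨_, h1⟩ ⟨_, h2⟩
    have h3 : u - u' ∈ pKer S.adjoint := by
      apply aux_mem_pKer_of_oo S hd
      have := Submodule.sub_mem _ h1 h2
      simpa using this
    have h4 := (aux_mem_pKer_iff S hd _).1 h3 (⟨u, hu⟩ - ⟨u', hu'⟩)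
    have h5 := hS.lower (⟨u, hu⟩ - ⟨u', hu'⟩)
    have h6 : ε * ‖u - u'‖ ^ 2 ≤ (⟪u - u', (S (⟨u, hu⟩ - ⟨u', hu'⟩) : H)⟫).re := h5
    rw [h4, Complex.zero_re] at h6
    have h7 : ‖u - u'‖ ^ 2 ≤ 0 := by
      by_contra hc
      push Not at hc
      have := mul_pos hS.pos hc
      linarith
    have h8 : ‖u - u'‖ = 0 := by
      have := sq_nonneg ‖u - u'‖
      exact pow_eq_zero_iff (two_ne_zero) |>.1 (le_antisymm h7 this)
    exact sub_eq_zero.1 (norm_eq_zero.1 h8)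
  · intro v hv hvo
    obtain ⟨hva, f, hf, -⟩ := (hK.2 v).1 hv
    have hc : CauchySeq (fun j => ((f j : S.domain) : H)) := by
      rw [Metric.cauchySeq_iff]
      intro δ hδ
      obtain ⟨N, hN⟩ := Metric.cauchySeq_iff.1 hf.cauchySeq (ε * δ) (mul_pos hS.pos hδ)
      refine ⟨N, fun m hm n hn => ?_⟩
      have h1 := hN m hm n hn
      have h2 := aux_bound S ε hS (f m - f n)
      rw [LinearPMap.map_sub] at h2
      rw [dist_eq_norm] at h1 ⊢
      exact lt_of_mul_lt_mul_left (lt_of_le_of_lt h2 h1) hS.pos.le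
    obtain ⟨u, hu⟩ := cauchySeq_tendsto_of_complete hc
    have hg : (u, S.adjoint ⟨v, hva⟩) ∈ (S.graph : Set (H × H)) :=
      IsClosed.mem_of_tendsto (f := fun j => (((f j : S.domain) : H), (S (f j) : H)))
        hS.closed (hu.prodMk_nhds hf) (Eventually.of_forall fun j => S.mem_graph (f j))
    obtain ⟨y, hy1, hy2⟩ := (LinearPMap.mem_graph_iff S).1 hg
    simp only at hy1 hy2
    refine ⟨u, hy1 ▸ y.2, hvo, ?_⟩
    apply Submodule.le_orthogonal_orthogonal
    rw [aux_mem_pKer_iff S hd]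
    intro x
    have h := LinearPMap.adjoint_isFormalAdjoint hd ⟨v, hva⟩ x
    rw [← hy2, hS.symmetric, hy1] at h
    rw [inner_sub_left, h, sub_self]
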